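/- Assume p is twice differentiable, J_π = J(0) < ∞, and that the limit lim_{t→0+} (1/n)·∫_{ℝⁿ} ‖∇²log p_t(y)‖_F²·p_t(y) dy exists and equals L := (1/n)·∫_{ℝⁿ} ‖∇²log p(y)‖_F²·p(y) dy < ∞. Then the function J is differentiable from the right at 0 with derivative J'(0) = −L, and the Bayes training error function admits the second-order expansion |Train(σ²) − σ⁴·J_π + σ⁶·L| = o(σ⁶) as σ² → 0+; that is, Train(σ²) = σ⁴·(1/n)·∫_{ℝⁿ} ‖∇log p(y)‖²·p(y) dy − σ⁶·(1/n)·∫_{ℝⁿ} ‖∇²log p(y)‖_F²·p(y) dy + o(σ⁶). -/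

import Mathlib

open MeasureTheory ProbabilityTheory Filter Set

noncomputable section

/-- Squared Euclidean norm of a vector in `Fin k → ℝ`. -/
def sqNorm {k : ℕ} (v : Fin k → ℝ) : ℝ := ∑ i, (v i) ^ 2

/-- Density of `N(0, t·I_n)` on `Fin n → ℝ`. -/
def gaussDensity {n : ℕ} (t : ℝ) (z : Fin n → ℝ) : ℝ :=
  (2 * Real.pi * t) ^ (-(n : ℝ) / 2) * Real.exp (-sqNorm z / (2 * t))

/-- Convolution `p_t = p * φ_t`, with the convention `p_0 = p`. -/
def pt {n : ℕ} (p : (Fin n → ℝ) → ℝ) (t : ℝ) (y : Fin n → ℝ) : ℝ :=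
  if t = 0 then p y else ∫ z, p z * gaussDensity t (y - z)

/-- Squared Euclidean norm of the gradient of a scalar function on `Fin k → ℝ`. -/
def gradSqNorm {k : ℕ} (q : (Fin k → ℝ) → ℝ) (z : Fin k → ℝ) : ℝ :=
  ∑ i, (fderiv ℝ q z (Pi.single i 1)) ^ 2

/-- Fisher information `(1/n)·∫ ‖∇ log q(z)‖² q(z) dz` of a density `q` on `Fin k → ℝ`. -/
def fisherInfo {k : ℕ} (q : (Fin k → ℝ) → ℝ) : ℝ :=
  (1 / (k : ℝ)) * ∫ z, gradSqNorm (fun w => Real.log (q w)) z * q z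

/-- The Fisher information function `J(t)` of the Gaussian-smoothed density. -/
def Jfun {n : ℕ} (p : (Fin n → ℝ) → ℝ) (t : ℝ) : ℝ :=
  fisherInfo (pt p t)

/-- The Bayes training error function `Train(t) = t²·J(t)`. -/
def TrainFun {n : ℕ} (p : (Fin n → ℝ) → ℝ) (t : ℝ) : ℝ :=
  t ^ 2 * Jfun p t

/-- Squared Frobenius norm of the Hessian of a scalar function on `Fin k → ℝ`. -/
def hessSqNorm {k : ℕ} (q : (Fin k → ℝ) → ℝ) (y : Fin k → ℝ) : ℝ :=
  ∑ i, ∑ j,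
    (fderiv ℝ (fun w => fderiv ℝ q w (Pi.single j 1)) y (Pi.single i 1)) ^ 2

open Topology MvPolynomial

lemma sqNorm_nonneg {k : ℕ} (v : Fin k → ℝ) : 0 ≤ sqNorm v :=
  Finset.sum_nonneg fun _ _ => sq_nonneg _

lemma sqNorm_continuous {k : ℕ} : Continuous (sqNorm (k := k)) := by
  unfold sqNorm; fun_prop

lemma sq_le_sqNorm {k : ℕ} (v : Fin k → ℝ) (i : Fin k) : (v i) ^ 2 ≤ sqNorm v :=
  Finset.single_le_sum (f := fun i => (v i) ^ 2) (fun _ _ => sq_nonneg _) (Finset.mem_univ i)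

lemma gaussDensity_pos {k : ℕ} {t : ℝ} (ht : 0 < t) (z : Fin k → ℝ) : 0 < gaussDensity t z := by
  unfold gaussDensity; positivity

lemma gaussDensity_continuous {k : ℕ} (t : ℝ) : Continuous (gaussDensity (n := k) t) := by
  unfold gaussDensity
  have := sqNorm_continuous (k := k)
  fun_prop

lemma integrable_exp_sqNorm {k : ℕ} {c : ℝ} (hc : 0 < c) :
    Integrable (fun w : Fin k → ℝ => Real.exp (-c * sqNorm w)) := by
  have h := Integrable.fintype_prod (ι := Fin k) (μ := fun _ => (volume : Measure ℝ))
    (f := fun _ x => Real.exp (-c * x ^ 2)) (fun _ => integrable_exp_neg_mul_sq hc)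
  refine h.congr (Eventually.of_forall fun w => ?_)
  simp only [sqNorm, ← Real.exp_sum, Finset.mul_sum]

lemma integral_gaussDensity {k : ℕ} {t : ℝ} (ht : 0 < t) :
    ∫ w : Fin k → ℝ, gaussDensity t w = 1 := by
  unfold gaussDensity
  rw [integral_const_mul]
  have : ∀ w : Fin k → ℝ, Real.exp (-sqNorm w / (2 * t))
      = ∏ i, Real.exp (-(1 / (2 * t)) * (w i) ^ 2) := by
    intro w
    rw [← Real.exp_sum, ← Finset.mul_sum]
    congr 1; unfold sqNorm; ring
  simp_rw [this]
  rw [integral_fintype_prod_volume_eq_pow (fun x : ℝ => Real.exp (-(1 / (2 * t)) * x ^ 2)),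
    integral_gaussian]
  have h2 : Real.pi / (1 / (2 * t)) = 2 * Real.pi * t := by field_simp
  rw [h2, Real.sqrt_eq_rpow, ← Real.rpow_natCast, ← Real.rpow_mul (by positivity),
    ← Real.rpow_add (by positivity)]
  have : -(k : ℝ) / 2 + 1 / 2 * (Fintype.card (Fin k) : ℝ) = 0 := by simp; ring
  rw [this, Real.rpow_zero]

/-- polynomial growth is absorbed by Gaussians -/
lemma poly_growth {k : ℕ} (f : MvPolynomial (Fin k) ℝ) :
    ∀ ε : ℝ, 0 < ε → ∃ C : ℝ, 0 ≤ C ∧ ∀ w : Fin k → ℝ, |eval w f| ≤ C * Real.exp (ε * sqNorm w) := by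
  induction f using MvPolynomial.induction_on with
  | C a =>
    intro ε hε
    refine ⟨|a|, abs_nonneg _, fun w => ?_⟩
    have : 1 ≤ Real.exp (ε * sqNorm w) := Real.one_le_exp (mul_nonneg hε.le (sqNorm_nonneg w))
    simp only [eval_C]
    nlinarith [abs_nonneg a]
  | add p q hp hq =>
    intro ε hε
    obtain ⟨C1, h1, hp⟩ := hp ε hε
    obtain ⟨C2, h2, hq⟩ := hq ε hε
    refine ⟨C1 + C2, by positivity, fun w => ?_⟩
    rw [map_add, add_mul]
    exact (abs_add_le _ _).trans (add_le_add (hp w) (hq w))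
  | mul_X p i hp =>
    intro ε hε
    obtain ⟨C1, h1, hp⟩ := hp (ε / 2) (by positivity)
    refine ⟨C1 * (1 + 2 / ε), by positivity, fun w => ?_⟩
    rw [map_mul, abs_mul, eval_X]
    have h3 : |w i| ≤ (1 + 2 / ε) * Real.exp (ε / 2 * sqNorm w) := by
      have e1 := Real.add_one_le_exp (ε / 2 * sqNorm w)
      have e2 := sq_le_sqNorm w i
      have e3 : |w i| ≤ 1 + (w i) ^ 2 := by
        rw [← sq_abs]; nlinarith [sq_nonneg (|w i| - 1), abs_nonneg (w i)]
      have e4 : sqNorm w = (2 / ε) * (ε / 2 * sqNorm w) := by field_simp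
      have e5 : (2 / ε) * (ε / 2 * sqNorm w) ≤ (2 / ε) * Real.exp (ε / 2 * sqNorm w) := by
        gcongr; linarith
      have e6 : 1 ≤ Real.exp (ε / 2 * sqNorm w) :=
        Real.one_le_exp (mul_nonneg (by positivity) (sqNorm_nonneg w))
      linarith
    calc |eval w p| * |w i| ≤ (C1 * Real.exp (ε / 2 * sqNorm w)) *
          ((1 + 2 / ε) * Real.exp (ε / 2 * sqNorm w)) := by
          gcongr; exact hp w
      _ = C1 * (1 + 2 / ε) * (Real.exp (ε / 2 * sqNorm w) * Real.exp (ε / 2 * sqNorm w)) := by ring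
      _ = _ := by rw [← Real.exp_add]; ring_nf

/-- uniform-in-time Gaussian domination -/
lemma poly_gauss_bound {k : ℕ} (f : MvPolynomial (Fin k) ℝ) {a b : ℝ} (ha : 0 < a) (hab : a ≤ b) :
    ∃ C : ℝ, 0 ≤ C ∧ ∀ t ∈ Icc a b, ∀ w : Fin k → ℝ,
      |eval w f * gaussDensity t w| ≤ C * Real.exp (-(1 / (4 * b)) * sqNorm w) := by
  have hb : 0 < b := ha.trans_le hab
  obtain ⟨C, hC, h⟩ := poly_growth f (1 / (4 * b)) (by positivity)
  refine ⟨C * (2 * Real.pi * a) ^ (-(k : ℝ) / 2), by positivity, fun t ht w => ?_⟩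
  have ht0 : 0 < t := ha.trans_le ht.1
  rw [abs_mul, abs_of_pos (gaussDensity_pos ht0 w)]
  unfold gaussDensity
  have h1 : (2 * Real.pi * t) ^ (-(k : ℝ) / 2) ≤ (2 * Real.pi * a) ^ (-(k : ℝ) / 2) := by
    apply Real.rpow_le_rpow_of_nonpos (by positivity)
    · have := ht.1; gcongr
    · have : (0 : ℝ) ≤ k := Nat.cast_nonneg k
      linarith
  have h2 : Real.exp (-sqNorm w / (2 * t)) ≤ Real.exp (-(1 / (2 * b)) * sqNorm w) := by
    apply Real.exp_le_exp.2
    have h3 : sqNorm w / (2 * b) ≤ sqNorm w / (2 * t) := by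
      have := ht.2
      have := sqNorm_nonneg w
      gcongr
    have e1 : -sqNorm w / (2 * t) = -(sqNorm w / (2 * t)) := by ring
    have e2 : -(1 / (2 * b)) * sqNorm w = -(sqNorm w / (2 * b)) := by ring
    rw [e1, e2]; linarith
  calc |eval w f| * ((2 * Real.pi * t) ^ (-(k : ℝ) / 2) * Real.exp (-sqNorm w / (2 * t)))
      ≤ (C * Real.exp (1 / (4 * b) * sqNorm w)) *
        ((2 * Real.pi * a) ^ (-(k : ℝ) / 2) * Real.exp (-(1 / (2 * b)) * sqNorm w)) := by
        gcongr; exact h w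
    _ = C * (2 * Real.pi * a) ^ (-(k : ℝ) / 2) *
        (Real.exp (1 / (4 * b) * sqNorm w) * Real.exp (-(1 / (2 * b)) * sqNorm w)) := by ring
    _ = _ := by
        rw [← Real.exp_add]; congr 2; field_simp; ring

lemma poly_continuous {k : ℕ} (f : MvPolynomial (Fin k) ℝ) :
    Continuous (fun w : Fin k → ℝ => eval w f) := MvPolynomial.continuous_eval f

/-- derivative of polynomial -/
lemma poly_hasFDerivAt {k : ℕ} (f : MvPolynomial (Fin k) ℝ) (w : Fin k → ℝ) :
    HasFDerivAt (fun w : Fin k → ℝ => eval w f)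
      (∑ j, eval w (pderiv j f) • (ContinuousLinearMap.proj j : (Fin k → ℝ) →L[ℝ] ℝ)) w := by
  induction f using MvPolynomial.induction_on with
  | C a => simpa using hasFDerivAt_const a w
  | add p q hp hq =>
    simp only [map_add, add_smul, Finset.sum_add_distrib]
    exact hp.add hq
  | mul_X p i hp =>
    have h := hp.mul (hasFDerivAt_apply i w)
    simp only [map_mul, eval_X]
    refine h.congr_fderiv ?_
    ext v
    simp only [add_apply, smul_apply, sum_apply,
      ContinuousLinearMap.proj_apply, smul_eq_mul, Derivation.leibniz, pderiv_X, map_add, map_mul,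
      eval_X, Pi.single_apply, add_mul, Finset.sum_add_distrib, Finset.mul_sum]
    congr 1
    · rw [Finset.sum_eq_single i]
      · simp
      · intro j _ hj; simp [hj.symm]
      · simp
    · refine Finset.sum_congr rfl fun j _ => ?_
      ring

/-- D t j f · φ_t = ∂_j (f φ_t) -/
def Dp {k : ℕ} (t : ℝ) (j : Fin k) (f : MvPolynomial (Fin k) ℝ) : MvPolynomial (Fin k) ℝ :=
  pderiv j f - C (1 / t) * (X j * f)

lemma gauss_hasFDerivAt {k : ℕ} (t : ℝ) (w : Fin k → ℝ) :
    HasFDerivAt (gaussDensity (n := k) t)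
      (∑ j, (-(w j / t) * gaussDensity t w) •
        (ContinuousLinearMap.proj j : (Fin k → ℝ) →L[ℝ] ℝ)) w := by
  have h1 : HasFDerivAt (sqNorm (k := k))
      (∑ j, (2 * w j) • (ContinuousLinearMap.proj j : (Fin k → ℝ) →L[ℝ] ℝ)) w := by
    unfold sqNorm
    apply HasFDerivAt.fun_sum
    intro i _
    have h0 : HasFDerivAt (fun f : Fin k → ℝ => f i)
      (ContinuousLinearMap.proj i : (Fin k → ℝ) →L[ℝ] ℝ) w := hasFDerivAt_apply i w
    simpa using h0.pow 2
  have h2 := (((h1.neg).mul_const (2 * t)⁻¹).exp).const_mul ((2 * Real.pi * t) ^ (-(k : ℝ) / 2))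
  refine h2.congr_fderiv ?_
  ext v
  simp only [gaussDensity, Finset.mul_sum, div_eq_mul_inv, smul_apply, sum_apply,
      ContinuousLinearMap.proj_apply, smul_eq_mul, neg_apply, mul_neg, ← Finset.sum_neg_distrib, Pi.neg_apply]
  refine Finset.sum_congr rfl fun j _ => ?_
  rw [mul_inv]
  ring

lemma kernel_hasFDerivAt {k : ℕ} (t : ℝ) (f : MvPolynomial (Fin k) ℝ) (w : Fin k → ℝ) :
    HasFDerivAt (fun w => eval w f * gaussDensity t w)
      (∑ j, (eval w (Dp t j f) * gaussDensity t w) •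
        (ContinuousLinearMap.proj j : (Fin k → ℝ) →L[ℝ] ℝ)) w := by
  refine ((poly_hasFDerivAt f w).mul (gauss_hasFDerivAt t w)).congr_fderiv ?_
  ext v
  simp only [Dp, map_sub, map_mul, eval_C, eval_X, add_apply,
    smul_apply, sum_apply, ContinuousLinearMap.proj_apply,
    smul_eq_mul, Finset.mul_sum, ← Finset.sum_add_distrib]
  refine Finset.sum_congr rfl fun j _ => ?_
  ring

lemma gauss_hasDerivAt_t {k : ℕ} {t : ℝ} (ht : 0 < t) (w : Fin k → ℝ) :
    HasDerivAt (fun t => gaussDensity t w)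
      ((sqNorm w / (2 * t ^ 2) - k / (2 * t)) * gaussDensity t w) t := by
  unfold gaussDensity
  have h1 : HasDerivAt (fun t : ℝ => 2 * Real.pi * t) (2 * Real.pi) t := by
    simpa using (hasDerivAt_id t).const_mul (2 * Real.pi)
  have h2 := h1.rpow_const (p := -(k : ℝ) / 2) (Or.inl (by positivity))
  have h3 : HasDerivAt (fun t : ℝ => -sqNorm w / (2 * t)) (sqNorm w / (2 * t ^ 2)) t := by
    have := ((hasDerivAt_id t).const_mul 2).fun_inv (by simp; positivity)
    have := this.const_mul (-sqNorm w)
    simp only [id] at this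
    refine (this.congr_deriv ?_).congr_of_eventuallyEq ?_
    · field_simp
    · exact Eventually.of_forall fun _ => by simp [div_eq_mul_inv]
  refine (h2.mul h3.exp).congr_deriv ?_
  rw [Real.rpow_sub_one (by positivity)]
  field_simp
  ring

/-- `A p f t y = ∫ p(z) f(y-z) φ_t(y-z) dz` -/
def Af {k : ℕ} (p : (Fin k → ℝ) → ℝ) (f : MvPolynomial (Fin k) ℝ) (t : ℝ) (y : Fin k → ℝ) : ℝ :=
  ∫ z, p z * (eval (y - z) f * gaussDensity t (y - z))

lemma kernel_continuous {k : ℕ} (f : MvPolynomial (Fin k) ℝ) (t : ℝ) :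
    Continuous (fun w : Fin k → ℝ => eval w f * gaussDensity t w) :=
  (poly_continuous f).mul (gaussDensity_continuous t)

lemma kernel_bdd {k : ℕ} (f : MvPolynomial (Fin k) ℝ) {a b : ℝ} (ha : 0 < a) (hab : a ≤ b) :
    ∃ C : ℝ, 0 ≤ C ∧ ∀ t ∈ Icc a b, ∀ w : Fin k → ℝ,
      |eval w f * gaussDensity t w| ≤ C := by
  obtain ⟨C, hC, h⟩ := poly_gauss_bound f ha hab
  refine ⟨C, hC, fun t ht w => (h t ht w).trans ?_⟩
  have : Real.exp (-(1 / (4 * b)) * sqNorm w) ≤ 1 := by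
    rw [Real.exp_le_one_iff]
    have := sqNorm_nonneg w
    have hb : 0 < b := ha.trans_le hab
    have : 0 ≤ 1 / (4 * b) := by positivity
    nlinarith
  nlinarith

lemma kernel_integrable {k : ℕ} (f : MvPolynomial (Fin k) ℝ) {t : ℝ} (ht : 0 < t) :
    Integrable (fun w : Fin k → ℝ => eval w f * gaussDensity t w) := by
  obtain ⟨C, hC, h⟩ := poly_gauss_bound f ht le_rfl
  refine ((integrable_exp_sqNorm (k := k) (c := 1 / (4 * t)) (by positivity)).const_mul C).mono'
    (kernel_continuous f t).aestronglyMeasurable (Eventually.of_forall fun w => ?_)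
  exact h t ⟨le_rfl, le_rfl⟩ w

lemma conv_integrand {k : ℕ} {p : (Fin k → ℝ) → ℝ} (hp : Integrable p) {g : (Fin k → ℝ) → ℝ}
    (hg : Continuous g) {C : ℝ} (hC : ∀ w, |g w| ≤ C) (y : Fin k → ℝ) :
    Integrable (fun z => p z * g (y - z)) := by
  refine hp.mul_bdd (c := C) ?_ (Eventually.of_forall fun z => hC _)
  exact (hg.comp (by fun_prop)).aestronglyMeasurable

lemma Af_integrand {k : ℕ} {p : (Fin k → ℝ) → ℝ} (hp : Integrable p)
    (f : MvPolynomial (Fin k) ℝ) {t : ℝ} (ht : 0 < t) (y : Fin k → ℝ) :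
    Integrable (fun z => p z * (eval (y - z) f * gaussDensity t (y - z))) := by
  obtain ⟨C, hC, h⟩ := kernel_bdd f ht le_rfl
  exact conv_integrand hp (kernel_continuous f t) (h t ⟨le_rfl, le_rfl⟩) y

lemma Af_hasFDerivAt {k : ℕ} {p : (Fin k → ℝ) → ℝ} (hp : Integrable p)
    (f : MvPolynomial (Fin k) ℝ) {t : ℝ} (ht : 0 < t) (y : Fin k → ℝ) :
    HasFDerivAt (Af p f t) (∑ j, Af p (Dp t j f) t y •
        (ContinuousLinearMap.proj j : (Fin k → ℝ) →L[ℝ] ℝ)) y := by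
  choose C hC h using fun j => kernel_bdd (Dp t j f) ht le_rfl
  set P : Fin k → ((Fin k → ℝ) →L[ℝ] ℝ) := fun j => ContinuousLinearMap.proj j with hP
  have key := hasFDerivAt_integral_of_dominated_of_fderiv_le (μ := volume) (𝕜 := ℝ)
    (F := fun y z => p z * (eval (y - z) f * gaussDensity t (y - z)))
    (F' := fun y z => ∑ j, (p z * (eval (y - z) (Dp t j f) * gaussDensity t (y - z))) • P j)
    (x₀ := y) (s := univ) (bound := fun z => ∑ j, |p z| * C j * ‖P j‖) univ_mem
    (Eventually.of_forall fun y => (Af_integrand hp f ht y).aestronglyMeasurable)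
    (Af_integrand hp f ht y) ?_ ?_ ?_ ?_
  · refine key.congr_fderiv ?_
    rw [integral_finsetSum]
    · refine Finset.sum_congr rfl fun j _ => ?_
      rw [integral_smul_const]; rfl
    · intro j _
      exact (Af_integrand hp _ ht y).smul_const _
  · refine Finset.aestronglyMeasurable_fun_sum _ fun j _ => ?_
    exact ((Af_integrand hp _ ht y).smul_const _).aestronglyMeasurable
  · refine Eventually.of_forall fun z x _ => ?_
    refine (norm_sum_le _ _).trans (Finset.sum_le_sum fun j _ => ?_)
    rw [norm_smul, norm_mul]
    have := h j t ⟨le_rfl, le_rfl⟩ (x - z)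
    simp only [Real.norm_eq_abs]
    gcongr
  · refine integrable_finsetSum _ fun j _ => ?_
    exact (hp.abs.mul_const _).mul_const _
  · refine Eventually.of_forall fun z x _ => ?_
    have h1 := (kernel_hasFDerivAt t f (x - z)).comp x ((hasFDerivAt_id x).sub_const z)
    refine (h1.const_mul (p z)).congr_fderiv ?_
    ext v
    simp [Finset.mul_sum, hP, mul_assoc]

lemma Af_differentiable {k : ℕ} {p : (Fin k → ℝ) → ℝ} (hp : Integrable p)
    (f : MvPolynomial (Fin k) ℝ) {t : ℝ} (ht : 0 < t) : Differentiable ℝ (Af p f t) :=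
  fun y => (Af_hasFDerivAt hp f ht y).differentiableAt

lemma Af_continuous {k : ℕ} {p : (Fin k → ℝ) → ℝ} (hp : Integrable p)
    (f : MvPolynomial (Fin k) ℝ) {t : ℝ} (ht : 0 < t) : Continuous (Af p f t) :=
  (Af_differentiable hp f ht).continuous

lemma Af_fderiv {k : ℕ} {p : (Fin k → ℝ) → ℝ} (hp : Integrable p)
    (f : MvPolynomial (Fin k) ℝ) {t : ℝ} (ht : 0 < t) (y : Fin k → ℝ) (j : Fin k) :
    fderiv ℝ (Af p f t) y (Pi.single j 1) = Af p (Dp t j f) t y := by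
  rw [(Af_hasFDerivAt hp f ht y).fderiv]
  simp [sum_apply, Pi.single_apply]

lemma Af_add {k : ℕ} {p : (Fin k → ℝ) → ℝ} (hp : Integrable p)
    (f g : MvPolynomial (Fin k) ℝ) {t : ℝ} (ht : 0 < t) (y : Fin k → ℝ) :
    Af p (f + g) t y = Af p f t y + Af p g t y := by
  unfold Af
  rw [← integral_add (Af_integrand hp f ht y) (Af_integrand hp g ht y)]
  congr 1; ext z; simp; ring

lemma Af_C_mul {k : ℕ} {p : (Fin k → ℝ) → ℝ} 
    (c : ℝ) (f : MvPolynomial (Fin k) ℝ) (t : ℝ) (y : Fin k → ℝ) :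
    Af p (C c * f) t y = c * Af p f t y := by
  unfold Af
  rw [← integral_const_mul]
  congr 1; ext z; simp; ring

lemma Af_sum {k : ℕ} {p : (Fin k → ℝ) → ℝ} (hp : Integrable p) {ι : Type*} (s : Finset ι)
    (f : ι → MvPolynomial (Fin k) ℝ) {t : ℝ} (ht : 0 < t) (y : Fin k → ℝ) :
    Af p (∑ i ∈ s, f i) t y = ∑ i ∈ s, Af p (f i) t y := by
  unfold Af
  rw [← integral_finsetSum _ fun i _ => Af_integrand hp (f i) ht y]
  congr 1; ext z; simp [Finset.sum_mul, Finset.mul_sum]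

/-- time-derivative polynomial -/
def Ep {k : ℕ} (t : ℝ) : MvPolynomial (Fin k) ℝ :=
  C (1 / (2 * t ^ 2)) * (∑ j, X j ^ 2) + C (-(k : ℝ) / (2 * t))

lemma eval_Ep {k : ℕ} (t : ℝ) (w : Fin k → ℝ) :
    eval w (Ep t) = sqNorm w / (2 * t ^ 2) - k / (2 * t) := by
  simp [Ep, sqNorm]; ring

lemma Af_hasDerivAt_t {k : ℕ} {p : (Fin k → ℝ) → ℝ} (hp : Integrable p)
    (f : MvPolynomial (Fin k) ℝ) {t : ℝ} (ht : 0 < t) (y : Fin k → ℝ) :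
    HasDerivAt (fun t => Af p f t y) (Af p (f * Ep t) t y) t := by
  have hab : t / 2 ≤ 2 * t := by linarith
  obtain ⟨C1, hC1, h1⟩ := kernel_bdd (f * ∑ j, X j ^ 2) (half_pos ht) hab
  obtain ⟨C2, hC2, h2⟩ := kernel_bdd f (half_pos ht) hab
  have key := hasDerivAt_integral_of_dominated_loc_of_deriv_le (μ := volume) (𝕜 := ℝ)
    (F := fun t z => p z * (eval (y - z) f * gaussDensity t (y - z)))
    (F' := fun t z => p z * (eval (y - z) (f * Ep t) * gaussDensity t (y - z)))
    (x₀ := t) (s := Icc (t / 2) (2 * t))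
    (bound := fun z => |p z| * (1 / (2 * (t / 2) ^ 2) * C1 + k / (2 * (t / 2)) * C2))
    (Icc_mem_nhds (by linarith) (by linarith)) ?_
    (Af_integrand hp f ht y) (Af_integrand hp _ ht y).aestronglyMeasurable ?_ ?_ ?_
  · exact key.2
  · filter_upwards [Ioi_mem_nhds ht] with s hs
    exact (Af_integrand hp f hs y).aestronglyMeasurable
  · refine Eventually.of_forall fun z s hs => ?_
    have hs0 : 0 < s := (half_pos ht).trans_le hs.1
    have b1 := h1 s hs (y - z)
    have b2 := h2 s hs (y - z)
    rw [norm_mul]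
    simp only [Real.norm_eq_abs]
    gcongr
    have e : eval (y - z) (f * Ep s) * gaussDensity s (y - z) =
      1 / (2 * s ^ 2) * (eval (y - z) (f * ∑ j, X j ^ 2) * gaussDensity s (y - z))
       - k / (2 * s) * (eval (y - z) f * gaussDensity s (y - z)) := by
      rw [map_mul, map_mul, eval_Ep]
      simp [sqNorm]; ring
    rw [e]
    refine (abs_sub _ _).trans ?_
    rw [abs_mul, abs_mul (k / (2 * s) : ℝ)]
    rw [abs_of_nonneg (by positivity : 0 ≤ 1 / (2 * s ^ 2)),
      abs_of_nonneg (by positivity : 0 ≤ k / (2 * s))]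
    have := hs.1
    gcongr
  · exact hp.abs.mul_const _
  · refine Eventually.of_forall fun z s hs => ?_
    have hs0 : 0 < s := (half_pos ht).trans_le hs.1
    refine (((gauss_hasDerivAt_t hs0 (y - z)).const_mul (eval (y - z) f)).const_mul
      (p z)).congr_deriv ?_
    rw [map_mul, eval_Ep]; ring

lemma Af_dom {k : ℕ} {p : (Fin k → ℝ) → ℝ} (hp : Integrable p)
    (f : MvPolynomial (Fin k) ℝ) {a b : ℝ} (ha : 0 < a) (hab : a ≤ b) :
    ∃ G : (Fin k → ℝ) → ℝ, Integrable G ∧ ∀ t ∈ Icc a b, ∀ y, |Af p f t y| ≤ G y := by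
  obtain ⟨C, hC, h⟩ := poly_gauss_bound f ha hab
  have hb : 0 < b := ha.trans_le hab
  have hi := (integrable_exp_sqNorm (k := k) (c := 1 / (4 * b)) (by positivity)).const_mul C
  have hc := hp.abs.integrable_convolution (ContinuousLinearMap.mul ℝ ℝ) hi
  refine ⟨_, hc, fun t ht y => ?_⟩
  unfold Af
  rw [← Real.norm_eq_abs]
  refine norm_integral_le_of_norm_le (g := fun z =>
    |p z| * (C * Real.exp (-(1 / (4 * b)) * sqNorm (y - z)))) ?_ (Eventually.of_forall fun z => ?_)
  · refine conv_integrand (C := C) hp.abs (g := fun w => C * Real.exp (-(1 / (4 * b)) * sqNorm w))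
      ?_ (fun w => ?_) y
    · have := sqNorm_continuous (k := k); fun_prop
    · rw [abs_of_nonneg (by positivity)]
      have : Real.exp (-(1 / (4 * b)) * sqNorm w) ≤ 1 := by
        rw [Real.exp_le_one_iff]
        have := sqNorm_nonneg w
        have : 0 ≤ 1 / (4 * b) := by positivity
        nlinarith
      nlinarith
  · rw [norm_mul]
    simp only [Real.norm_eq_abs]
    gcongr
    exact h t ht _

lemma Af_integrable {k : ℕ} {p : (Fin k → ℝ) → ℝ} (hp : Integrable p)
    (f : MvPolynomial (Fin k) ℝ) {t : ℝ} (ht : 0 < t) : Integrable (Af p f t) := by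
  obtain ⟨G, hG, h⟩ := Af_dom hp f ht le_rfl
  exact hG.mono' (Af_continuous hp f ht).aestronglyMeasurable
    (Eventually.of_forall fun y => h t ⟨le_rfl, le_rfl⟩ y)

lemma Af_one_pos {k : ℕ} {p : (Fin k → ℝ) → ℝ} (hp : Integrable p) (hpos : ∀ z, 0 < p z)
    {t : ℝ} (ht : 0 < t) (y : Fin k → ℝ) : 0 < Af p 1 t y := by
  unfold Af
  have hh : ∀ z, 0 < p z * (eval (y - z) (1 : MvPolynomial (Fin k) ℝ) * gaussDensity t (y - z)) := by
    intro z
    have := gaussDensity_pos ht (y - z)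
    have := hpos z
    simp only [map_one]; positivity
  rw [integral_pos_iff_support_of_nonneg (fun z => (hh z).le) (Af_integrand hp 1 ht y)]
  have : Function.support (fun z => p z * (eval (y - z) (1 : MvPolynomial (Fin k) ℝ) *
      gaussDensity t (y - z))) = univ := by
    ext z; simpa [Function.mem_support] using (hh z).ne'
  rw [this]; exact isOpen_univ.measure_pos volume univ_nonempty

lemma weighted_CS {k : ℕ} {m h : (Fin k → ℝ) → ℝ} (hm0 : ∀ z, 0 ≤ m z) (hm : Integrable m)
    (hmpos : 0 < ∫ z, m z) (h1 : Integrable (fun z => h z * m z))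
    (h2 : Integrable (fun z => h z ^ 2 * m z)) :
    (∫ z, h z * m z) ^ 2 / (∫ z, m z) ≤ ∫ z, h z ^ 2 * m z := by
  set M := ∫ z, m z
  set H := ∫ z, h z * m z
  have h0 : 0 ≤ ∫ z, (h z - H / M) ^ 2 * m z :=
    integral_nonneg fun z => mul_nonneg (sq_nonneg _) (hm0 z)
  have e : ∫ z, (h z - H / M) ^ 2 * m z = (∫ z, h z ^ 2 * m z) - 2 * (H / M) * H + (H / M) ^ 2 * M := by
    have e1 : ∀ z, (h z - H / M) ^ 2 * m z = (h z ^ 2 * m z - 2 * (H / M) * (h z * m z)) +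
      (H / M) ^ 2 * m z := fun z => by ring
    simp_rw [e1]
    have hs : Integrable (fun z => h z ^ 2 * m z - 2 * (H / M) * (h z * m z)) :=
      h2.sub (h1.const_mul _)
    rw [integral_add hs (hm.const_mul _), integral_sub h2 (h1.const_mul _),
      integral_const_mul, integral_const_mul]
  rw [e] at h0
  have : 2 * (H / M) * H - (H / M) ^ 2 * M = H ^ 2 / M := by field_simp; ring
  linarith

lemma Af_CS {k : ℕ} {p : (Fin k → ℝ) → ℝ} (hp : Integrable p) (hpos : ∀ z, 0 < p z)
    (f : MvPolynomial (Fin k) ℝ) {t : ℝ} (ht : 0 < t) (y : Fin k → ℝ) :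
    Af p f t y ^ 2 / Af p 1 t y ≤ Af p (f ^ 2) t y := by
  have := weighted_CS (m := fun z => p z * (eval (y - z) (1 : MvPolynomial (Fin k) ℝ) *
      gaussDensity t (y - z))) (h := fun z => eval (y - z) f)
    (fun z => by
      have := gaussDensity_pos ht (y - z)
      have := hpos z
      simp only [map_one]; positivity) (Af_integrand hp 1 ht y) (Af_one_pos hp hpos ht y)
    ((Af_integrand hp f ht y).congr (Eventually.of_forall fun z => by simp; ring))
    ((Af_integrand hp (f ^ 2) ht y).congr (Eventually.of_forall fun z => by simp; ring))
  have e1 : ∫ z, eval (y - z) f * (p z * (eval (y - z) (1 : MvPolynomial (Fin k) ℝ) *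
      gaussDensity t (y - z))) = Af p f t y := by
    unfold Af; congr 1; ext z; simp; ring
  have e2 : ∫ z, (eval (y - z) f) ^ 2 * (p z * (eval (y - z) (1 : MvPolynomial (Fin k) ℝ) *
      gaussDensity t (y - z))) = Af p (f ^ 2) t y := by
    unfold Af; congr 1; ext z; simp; ring
  rw [e1, e2] at this
  exact this

/-- ratio `R f = A f / A 1` -/
def Rf {k : ℕ} (p : (Fin k → ℝ) → ℝ) (f : MvPolynomial (Fin k) ℝ) (t : ℝ) (y : Fin k → ℝ) : ℝ :=
  Af p f t y / Af p 1 t y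

lemma Rf_four {k : ℕ} {p : (Fin k → ℝ) → ℝ} (hp : Integrable p) (hpos : ∀ z, 0 < p z)
    (f : MvPolynomial (Fin k) ℝ) {t : ℝ} (ht : 0 < t) (y : Fin k → ℝ) :
    Af p 1 t y * Rf p f t y ^ 4 ≤ Af p (f ^ 4) t y := by
  have h1 := Af_CS hp hpos f ht y
  have h2 := Af_CS hp hpos (f ^ 2) ht y
  rw [← pow_mul] at h2
  have h0 := Af_one_pos hp hpos ht y
  refine le_trans ?_ h2
  have : (Af p f t y ^ 2 / Af p 1 t y) ^ 2 ≤ Af p (f ^ 2) t y ^ 2 := by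
    apply pow_le_pow_left₀ (by positivity) h1
  have e : Af p 1 t y * Rf p f t y ^ 4 = (Af p f t y ^ 2 / Af p 1 t y) ^ 2 / Af p 1 t y := by
    unfold Rf; field_simp
  rw [e]; gcongr

/-- `u R f R g R h R k` -/
def Qf {k : ℕ} (p : (Fin k → ℝ) → ℝ) (f g h l : MvPolynomial (Fin k) ℝ) (t : ℝ)
    (y : Fin k → ℝ) : ℝ :=
  Af p 1 t y * (Rf p f t y * Rf p g t y * Rf p h t y * Rf p l t y)

lemma Qf_bound {k : ℕ} {p : (Fin k → ℝ) → ℝ} (hp : Integrable p) (hpos : ∀ z, 0 < p z)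
    (f g h l : MvPolynomial (Fin k) ℝ) {t : ℝ} (ht : 0 < t) (y : Fin k → ℝ) :
    |Qf p f g h l t y| ≤ Af p (f ^ 4 + g ^ 4 + h ^ 4 + l ^ 4) t y := by
  rw [Af_add hp _ _ ht, Af_add hp _ _ ht, Af_add hp _ _ ht]
  have b1 := Rf_four hp hpos f ht y
  have b2 := Rf_four hp hpos g ht y
  have b3 := Rf_four hp hpos h ht y
  have b4 := Rf_four hp hpos l ht y
  have h0 := Af_one_pos hp hpos ht y
  unfold Qf
  have amgm : ∀ a b c d : ℝ, |a * b * c * d| ≤ a ^ 4 + b ^ 4 + c ^ 4 + d ^ 4 := by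
    intro a b c d
    rw [abs_le]
    constructor <;> nlinarith [sq_nonneg (a * b - c * d), sq_nonneg (a * b + c * d),
      sq_nonneg (a ^ 2 - b ^ 2), sq_nonneg (c ^ 2 - d ^ 2), sq_nonneg (a ^ 2), sq_nonneg (b ^ 2),
      sq_nonneg (c ^ 2), sq_nonneg (d ^ 2)]
  rw [abs_mul, abs_of_pos h0]
  have := mul_le_mul_of_nonneg_left (amgm (Rf p f t y) (Rf p g t y) (Rf p h t y) (Rf p l t y)) h0.le
  linarith

lemma Rf_continuous {k : ℕ} {p : (Fin k → ℝ) → ℝ} (hp : Integrable p) (hpos : ∀ z, 0 < p z)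
    (f : MvPolynomial (Fin k) ℝ) {t : ℝ} (ht : 0 < t) : Continuous (Rf p f t) :=
  (Af_continuous hp f ht).div (Af_continuous hp 1 ht) fun y => (Af_one_pos hp hpos ht y).ne'

lemma Qf_continuous {k : ℕ} {p : (Fin k → ℝ) → ℝ} (hp : Integrable p) (hpos : ∀ z, 0 < p z)
    (f g h l : MvPolynomial (Fin k) ℝ) {t : ℝ} (ht : 0 < t) : Continuous (Qf p f g h l t) :=
  (Af_continuous hp 1 ht).mul ((((Rf_continuous hp hpos f ht).mul (Rf_continuous hp hpos g ht)).mul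
    (Rf_continuous hp hpos h ht)).mul (Rf_continuous hp hpos l ht))

lemma Qf_dom {k : ℕ} {p : (Fin k → ℝ) → ℝ} (hp : Integrable p) (hpos : ∀ z, 0 < p z)
    (f g h l : MvPolynomial (Fin k) ℝ) {a b : ℝ} (ha : 0 < a) (hab : a ≤ b) :
    ∃ G : (Fin k → ℝ) → ℝ, Integrable G ∧ ∀ t ∈ Icc a b, ∀ y, |Qf p f g h l t y| ≤ G y := by
  obtain ⟨G, hG, hh⟩ := Af_dom hp (f ^ 4 + g ^ 4 + h ^ 4 + l ^ 4) ha hab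
  exact ⟨G, hG, fun t ht y => (Qf_bound hp hpos f g h l (ha.trans_le ht.1) y).trans
    ((le_abs_self _).trans (hh t ht y))⟩

lemma Qf_integrable {k : ℕ} {p : (Fin k → ℝ) → ℝ} (hp : Integrable p) (hpos : ∀ z, 0 < p z)
    (f g h l : MvPolynomial (Fin k) ℝ) {t : ℝ} (ht : 0 < t) : Integrable (Qf p f g h l t) := by
  obtain ⟨G, hG, hh⟩ := Qf_dom hp hpos f g h l ht le_rfl
  exact hG.mono' (Qf_continuous hp hpos f g h l ht).aestronglyMeasurable
    (Eventually.of_forall fun y => hh t ⟨le_rfl, le_rfl⟩ y)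

lemma pt_eq_Af {k : ℕ} (p : (Fin k → ℝ) → ℝ) {t : ℝ} (ht : 0 < t) : pt p t = Af p 1 t := by
  ext y
  simp [pt, Af, ht.ne']

section fixed
variable {k : ℕ} {p : (Fin k → ℝ) → ℝ}

lemma log_pt_fderiv (hp : Integrable p) (hpos : ∀ z, 0 < p z) {t : ℝ} (ht : 0 < t)
    (y : Fin k → ℝ) (j : Fin k) :
    fderiv ℝ (fun w => Real.log (pt p t w)) y (Pi.single j 1) = Rf p (Dp t j 1) t y := by
  rw [pt_eq_Af p ht]
  have h := (Af_differentiable hp 1 ht y).hasFDerivAt.log (Af_one_pos hp hpos ht y).ne'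
  rw [h.fderiv, smul_apply, Af_fderiv hp 1 ht, smul_eq_mul, Rf]
  field_simp

lemma Rf_hasFDerivAt (hp : Integrable p) (hpos : ∀ z, 0 < p z) (f : MvPolynomial (Fin k) ℝ)
    {t : ℝ} (ht : 0 < t) (y : Fin k → ℝ) :
    DifferentiableAt ℝ (Rf p f t) y ∧ ∀ j, fderiv ℝ (Rf p f t) y (Pi.single j 1) =
      Rf p (Dp t j f) t y - Rf p f t y * Rf p (Dp t j 1) t y := by
  have h0 := Af_one_pos hp hpos ht y
  have h1 := (Af_differentiable hp f ht y).hasFDerivAt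
  have h2 := (Af_differentiable hp 1 ht y).hasFDerivAt
  have h3 : HasFDerivAt (Rf p f t) _ y :=
    h1.mul ((hasDerivAt_inv h0.ne').comp_hasFDerivAt y h2)
  refine ⟨h3.differentiableAt, fun j => ?_⟩
  rw [h3.fderiv]
  simp only [smul_apply, add_apply, smul_eq_mul, Af_fderiv hp _ ht, Rf, Function.comp_apply]
  field_simp
  ring

/-- `v_ij` -/
def Vf (p : (Fin k → ℝ) → ℝ) (i j : Fin k) (t : ℝ) (y : Fin k → ℝ) : ℝ :=
  Rf p (Dp t j (Dp t i 1)) t y - Rf p (Dp t i 1) t y * Rf p (Dp t j 1) t y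

lemma log_pt_hess (hp : Integrable p) (hpos : ∀ z, 0 < p z) {t : ℝ} (ht : 0 < t)
    (y : Fin k → ℝ) (i j : Fin k) :
    fderiv ℝ (fun w => fderiv ℝ (fun w => Real.log (pt p t w)) w (Pi.single i 1)) y
      (Pi.single j 1) = Vf p i j t y := by
  simp_rw [log_pt_fderiv hp hpos ht]
  exact (Rf_hasFDerivAt hp hpos _ ht y).2 j

lemma Rf_one (hp : Integrable p) (hpos : ∀ z, 0 < p z) {t : ℝ} (ht : 0 < t)
    (y : Fin k → ℝ) : Rf p 1 t y = 1 := div_self (Af_one_pos hp hpos ht y).ne'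

lemma V_sq_eq (hp : Integrable p) (hpos : ∀ z, 0 < p z) {t : ℝ} (ht : 0 < t)
    (i j : Fin k) : (fun y => Vf p i j t y ^ 2 * Af p 1 t y) = fun y =>
      Qf p (Dp t j (Dp t i 1)) (Dp t j (Dp t i 1)) 1 1 t y
      - 2 * Qf p (Dp t i 1) (Dp t j 1) (Dp t j (Dp t i 1)) 1 t y
      + Qf p (Dp t i 1) (Dp t i 1) (Dp t j 1) (Dp t j 1) t y := by
  ext y
  simp only [Vf, Qf, Rf_one hp hpos ht]
  ring

lemma V_sq_integrable (hp : Integrable p) (hpos : ∀ z, 0 < p z) {t : ℝ} (ht : 0 < t)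
    (i j : Fin k) : Integrable (fun y => Vf p i j t y ^ 2 * Af p 1 t y) := by
  rw [V_sq_eq hp hpos ht]
  exact ((Qf_integrable hp hpos _ _ _ _ ht).sub
    ((Qf_integrable hp hpos _ _ _ _ ht).const_mul 2)).add (Qf_integrable hp hpos _ _ _ _ ht)

lemma ibp_zero {F : (Fin k → ℝ) → ℝ} (hF : Differentiable ℝ F) (hi : Integrable F) (v : Fin k → ℝ)
    (hi' : Integrable (fun y => fderiv ℝ F y v)) : ∫ y, fderiv ℝ F y v = 0 := by
  have := integral_mul_fderiv_eq_neg_fderiv_mul_of_integrable (μ := volume) (f := fun _ => (1 : ℝ))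
    (g := F) (v := v) (by simp) (by simpa using hi') (by simpa using hi)
    (fun x _ => differentiableAt_const _) (fun x _ => hF x)
  simpa using this

lemma ibp_main (hp : Integrable p) (hpos : ∀ z, 0 < p z) {t : ℝ} (ht : 0 < t) (i j : Fin k) :
    ∫ y, (Qf p (Dp t i 1) (Dp t j (Dp t j (Dp t i 1))) 1 1 t y
      - 1 / 2 * Qf p (Dp t i 1) (Dp t i 1) (Dp t j (Dp t j 1)) 1 t y)
      = - ∫ y, Vf p i j t y ^ 2 * Af p 1 t y := by
  set F : (Fin k → ℝ) → ℝ := fun y => Rf p (Dp t i 1) t y * Af p (Dp t j (Dp t i 1)) t y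
    - 1 / 2 * (Rf p (Dp t i 1) t y * Rf p (Dp t i 1) t y * Af p (Dp t j 1) t y) with hF
  have hA : ∀ f y, Af p 1 t y * Rf p f t y = Af p f t y := fun f y => by
    have := (Af_one_pos hp hpos ht y).ne'
    unfold Rf; field_simp
  have hFQ : F = fun y => Qf p (Dp t i 1) (Dp t j (Dp t i 1)) 1 1 t y
      - 1 / 2 * Qf p (Dp t i 1) (Dp t i 1) (Dp t j 1) 1 t y := by
    ext y
    simp only [hF, Qf, Rf_one hp hpos ht, ← hA (Dp t j (Dp t i 1)), ← hA (Dp t j 1)]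
    ring
  have hFi : Integrable F := by
    rw [hFQ]
    exact (Qf_integrable hp hpos _ _ _ _ ht).sub
      ((Qf_integrable hp hpos _ _ _ _ ht).const_mul _)
  have hd : ∀ y, HasFDerivAt F _ y := fun y =>
    ((Rf_hasFDerivAt hp hpos (Dp t i 1) ht y).1.hasFDerivAt.mul
      (Af_differentiable hp (Dp t j (Dp t i 1)) ht y).hasFDerivAt).sub
    ((((Rf_hasFDerivAt hp hpos (Dp t i 1) ht y).1.hasFDerivAt.mul
      (Rf_hasFDerivAt hp hpos (Dp t i 1) ht y).1.hasFDerivAt).mul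
      (Af_differentiable hp (Dp t j 1) ht y).hasFDerivAt).const_mul (1 / 2))
  have hd' : (fun y => fderiv ℝ F y (Pi.single j 1)) = fun y =>
      (Vf p i j t y ^ 2 * Af p 1 t y) +
      (Qf p (Dp t i 1) (Dp t j (Dp t j (Dp t i 1))) 1 1 t y
      - 1 / 2 * Qf p (Dp t i 1) (Dp t i 1) (Dp t j (Dp t j 1)) 1 t y) := by
    ext y
    rw [(hd y).fderiv]
    simp only [smul_apply, sub_apply, add_apply, smul_eq_mul, Af_fderiv hp _ ht,
      (Rf_hasFDerivAt hp hpos _ ht y).2, Qf, Rf_one hp hpos ht, Vf, ← hA (Dp t j (Dp t i 1)),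
      ← hA (Dp t j 1), ← hA (Dp t j (Dp t j (Dp t i 1))), ← hA (Dp t j (Dp t j 1)), Pi.mul_apply]
    ring
  have hQ : Integrable (fun y => (Qf p (Dp t i 1) (Dp t j (Dp t j (Dp t i 1))) 1 1 t y
      - 1 / 2 * Qf p (Dp t i 1) (Dp t i 1) (Dp t j (Dp t j 1)) 1 t y)) :=
    (Qf_integrable hp hpos _ _ _ _ ht).sub ((Qf_integrable hp hpos _ _ _ _ ht).const_mul _)
  have h0 := ibp_zero (fun y => (hd y).differentiableAt) hFi (Pi.single j 1) (by
    rw [hd']; exact (V_sq_integrable hp hpos ht i j).add hQ)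
  rw [hd', integral_add (V_sq_integrable hp hpos ht i j) hQ] at h0
  linarith

lemma heat_poly_one {t : ℝ} (ht : 0 < t) :
    (Ep t : MvPolynomial (Fin k) ℝ) = C (1 / 2) * ∑ j, Dp t j (Dp t j 1) := by
  have : ∀ j : Fin k, Dp t j (Dp t j 1) = C (1 / t ^ 2) * X j ^ 2 - C (1 / t) := by
    intro j
    have e : C (1 / t ^ 2) = (C (1 / t) * C (1 / t) : MvPolynomial (Fin k) ℝ) := by
      rw [← C_mul]; congr 1; field_simp
    simp only [Dp, map_sub, Derivation.leibniz, pderiv_C, pderiv_one, pderiv_X_self, e, map_zero,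
      mul_one, smul_eq_mul]
    ring
  simp_rw [this]
  rw [Finset.sum_sub_distrib, ← Finset.mul_sum, Ep]
  simp only [Finset.sum_const, Finset.card_univ, Fintype.card_fin, nsmul_eq_mul]
  rw [mul_sub, ← mul_assoc, ← C_mul, sub_eq_add_neg]
  congr 1
  · congr 2; field_simp
  · rw [← map_natCast (C : ℝ →+* MvPolynomial (Fin k) ℝ) k, ← C_mul, ← C_mul, ← C_neg]
    congr 1; field_simp

lemma heat_poly_X {t : ℝ} (ht : 0 < t) (i : Fin k) :
    (C (1 / t ^ 2) * X i + C (-(1 / t)) * (X i * Ep t) : MvPolynomial (Fin k) ℝ)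
      = C (1 / 2) * ∑ j, Dp t j (Dp t j (Dp t i 1)) := by
  have e : C (1 / t ^ 2) = (C (1 / t) * C (1 / t) : MvPolynomial (Fin k) ℝ) := by
    rw [← C_mul]; congr 1; field_simp
  have : ∀ j : Fin k, Dp t j (Dp t j (Dp t i 1)) = (if j = i then C (2 / t ^ 2) * X i else 0)
      + C (-(1 / t)) * X i * Dp t j (Dp t j 1) := by
    intro j
    have e2 : C (2 / t ^ 2) = (2 * (C (1 / t) * C (1 / t)) : MvPolynomial (Fin k) ℝ) := by
      rw [← C_mul, ← map_ofNat (C : ℝ →+* MvPolynomial (Fin k) ℝ) 2, ← C_mul]; congr 1; field_simp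
    by_cases h : j = i
    · subst h
      simp only [Dp, map_sub, Derivation.leibniz, pderiv_C, pderiv_one, pderiv_X_self, e2, map_zero,
        mul_one, smul_eq_mul, if_true, C_neg, map_one, map_add, Derivation.map_one_eq_zero]
      ring
    · simp only [Dp, map_sub, Derivation.leibniz, pderiv_C, pderiv_one, pderiv_X_self, map_zero,
        mul_one, smul_eq_mul, if_neg h, C_neg, map_one, map_add, Derivation.map_one_eq_zero,
        pderiv_X_of_ne (Ne.symm h)]
      ring
  simp_rw [this]
  rw [Finset.sum_add_distrib, ← Finset.mul_sum, Finset.sum_ite_eq' , heat_poly_one ht]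
  simp only [Finset.mem_univ, if_true]
  have : (1 : ℝ) / t ^ 2 = 1 / 2 * (2 / t ^ 2) := by ring
  rw [this, C_mul]; ring

/-- pointwise time derivative of `u_i²/u` (times t²) -/
def dQ (p : (Fin k → ℝ) → ℝ) (i : Fin k) (t : ℝ) (y : Fin k → ℝ) : ℝ :=
  1 / (2 * t ^ 2) * (2 * Qf p (X i) (X i * ∑ j, X j ^ 2) 1 1 t y
    - Qf p (X i) (X i) (∑ j, X j ^ 2) 1 t y)
   + (-(k : ℝ) / (2 * t)) * Qf p (X i) (X i) 1 1 t y

lemma Q_hasDerivAt (hp : Integrable p) (hpos : ∀ z, 0 < p z) {t : ℝ} (ht : 0 < t) (i : Fin k)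
    (y : Fin k → ℝ) : HasDerivAt (fun t => Qf p (X i) (X i) 1 1 t y) (dQ p i t y) t := by
  have h0 := Af_one_pos hp hpos ht y
  have hX := Af_hasDerivAt_t hp (X i) ht y
  have h1 := Af_hasDerivAt_t hp 1 ht y
  have h := (hX.mul hX).div h1 h0.ne'
  refine (h.congr_deriv ?_).congr_of_eventuallyEq ?_
  · have e1 : Af p (X i * Ep t) t y = 1 / (2 * t ^ 2) * Af p (X i * ∑ j, X j ^ 2) t y
      + (-(k : ℝ) / (2 * t)) * Af p (X i) t y := by
      rw [← Af_C_mul, ← Af_C_mul, ← Af_add hp _ _ ht]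
      congr 1; unfold Ep; ring
    have e2 : Af p (1 * Ep t) t y = 1 / (2 * t ^ 2) * Af p (∑ j, X j ^ 2) t y
      + (-(k : ℝ) / (2 * t)) * Af p 1 t y := by
      rw [← Af_C_mul, ← Af_C_mul, ← Af_add hp _ _ ht]
      congr 1; unfold Ep; ring
    rw [e1, e2]
    unfold dQ Qf
    simp only [Rf_one hp hpos ht, Pi.mul_apply]
    unfold Rf
    field_simp
    ring
  · filter_upwards [Ioi_mem_nhds ht] with s hs
    have h0 := Af_one_pos hp hpos hs y
    simp only [Qf, Rf_one hp hpos hs, Pi.mul_apply, Pi.div_apply]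
    unfold Rf
    field_simp

lemma intQ_hasDerivAt (hp : Integrable p) (hpos : ∀ z, 0 < p z) {t : ℝ} (ht : 0 < t) (i : Fin k) :
    Integrable (dQ p i t) ∧
    HasDerivAt (fun t => ∫ y, Qf p (X i) (X i) 1 1 t y) (∫ y, dQ p i t y) t := by
  have hab : t / 2 ≤ 2 * t := by linarith
  obtain ⟨G1, hG1, h1⟩ := Qf_dom hp hpos (X i) (X i * ∑ j, X j ^ 2) 1 1 (half_pos ht) hab
  obtain ⟨G2, hG2, h2⟩ := Qf_dom hp hpos (X i) (X i) (∑ j, X j ^ 2) 1 (half_pos ht) hab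
  obtain ⟨G3, hG3, h3⟩ := Qf_dom hp hpos (X i) (X i) 1 1 (half_pos ht) hab
  refine hasDerivAt_integral_of_dominated_loc_of_deriv_le (μ := volume) (𝕜 := ℝ)
    (F := fun t y => Qf p (X i) (X i) 1 1 t y)
    (F' := fun t y => dQ p i t y)
    (x₀ := t) (s := Icc (t / 2) (2 * t))
    (bound := fun y => 1 / (2 * (t / 2) ^ 2) * (2 * G1 y + G2 y) + k / (2 * (t / 2)) * G3 y)
    (Icc_mem_nhds (by linarith) (by linarith)) ?_
    (Qf_integrable hp hpos _ _ _ _ ht) ?_ ?_ ?_ ?_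
  · filter_upwards [Ioi_mem_nhds ht] with s hs
    exact (Qf_integrable hp hpos _ _ _ _ hs).aestronglyMeasurable
  · unfold dQ
    exact (((((Qf_integrable hp hpos _ _ _ _ ht).const_mul 2).sub
      (Qf_integrable hp hpos _ _ _ _ ht)).const_mul _).add
      ((Qf_integrable hp hpos _ _ _ _ ht).const_mul _)).aestronglyMeasurable
  · refine Eventually.of_forall fun y s hs => ?_
    have hs0 : 0 < s := (half_pos ht).trans_le hs.1
    have b1 := h1 s hs y
    have b2 := h2 s hs y
    have b3 := h3 s hs y
    have p1 := (abs_nonneg _).trans b1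
    have p2 := (abs_nonneg _).trans b2
    rw [Real.norm_eq_abs]
    unfold dQ
    refine (abs_add_le _ _).trans ?_
    rw [abs_mul, abs_mul (-(k : ℝ) / (2 * s))]
    rw [abs_of_nonneg (by positivity : 0 ≤ 1 / (2 * s ^ 2)), neg_div, abs_neg,
      abs_of_nonneg (by positivity : 0 ≤ k / (2 * s))]
    have hs1 := hs.1
    have b4 : |2 * Qf p (X i) (X i * ∑ j, X j ^ 2) 1 1 s y - Qf p (X i) (X i) (∑ j, X j ^ 2) 1 s y|
        ≤ 2 * G1 y + G2 y := by
      refine (abs_sub _ _).trans ?_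
      rw [abs_mul, abs_two]; linarith
    gcongr
  · exact (((hG1.const_mul 2).add hG2).const_mul _).add (hG3.const_mul _)
  · refine Eventually.of_forall fun y s hs => ?_
    exact Q_hasDerivAt hp hpos ((half_pos ht).trans_le hs.1) i y

lemma Dp_one (t : ℝ) (i : Fin k) : Dp t i 1 = C (-(1 / t)) * X i := by
  simp [Dp]

lemma heat_pointwise (hp : Integrable p) (hpos : ∀ z, 0 < p z) {t : ℝ} (ht : 0 < t) (i : Fin k)
    (y : Fin k → ℝ) :
    -2 / t ^ 3 * Qf p (X i) (X i) 1 1 t y + 1 / t ^ 2 * dQ p i t y =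
    ∑ j, (Qf p (Dp t i 1) (Dp t j (Dp t j (Dp t i 1))) 1 1 t y
      - 1 / 2 * Qf p (Dp t i 1) (Dp t i 1) (Dp t j (Dp t j 1)) 1 t y) := by
  have h0 := Af_one_pos hp hpos ht y
  have e1 : ∑ j, Af p (Dp t j (Dp t j (Dp t i 1))) t y =
      2 * (1 / t ^ 2 * Af p (X i) t y + (-(1 / t)) * (1 / (2 * t ^ 2) * Af p (X i * ∑ j, X j ^ 2) t y
      + (-(k : ℝ) / (2 * t)) * Af p (X i) t y)) := by
    have hx := congrArg (fun f => Af p f t y) (heat_poly_X ht i)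
    simp only [Af_C_mul, Af_sum hp _ _ ht, Af_add hp _ _ ht] at hx
    have e3 : Af p (X i * Ep t) t y = 1 / (2 * t ^ 2) * Af p (X i * ∑ j, X j ^ 2) t y
      + (-(k : ℝ) / (2 * t)) * Af p (X i) t y := by
      rw [← Af_C_mul, ← Af_C_mul, ← Af_add hp _ _ ht]
      congr 1; unfold Ep; ring
    rw [e3] at hx
    linarith
  have e2 : ∑ j, Af p (Dp t j (Dp t j 1)) t y =
      2 * (1 / (2 * t ^ 2) * Af p (∑ j, X j ^ 2) t y
      + (-(k : ℝ) / (2 * t)) * Af p 1 t y) := by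
    have hx := congrArg (fun f => Af p f t y) (heat_poly_one (k := k) ht)
    have e3 : Af p (Ep t) t y = 1 / (2 * t ^ 2) * Af p (∑ j, X j ^ 2) t y
      + (-(k : ℝ) / (2 * t)) * Af p 1 t y := by
      rw [← Af_C_mul, ← Af_C_mul, ← Af_add hp _ _ ht]
      congr 1; unfold Ep; ring
    simp only [Af_C_mul, Af_sum hp Finset.univ _ ht] at hx
    rw [e3] at hx
    linarith
  have e4 : Rf p (Dp t i 1) t y = -(1 / t) * Rf p (X i) t y := by
    unfold Rf
    rw [Dp_one, Af_C_mul]; ring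
  have e5 : ∑ j, (Qf p (Dp t i 1) (Dp t j (Dp t j (Dp t i 1))) 1 1 t y
      - 1 / 2 * Qf p (Dp t i 1) (Dp t i 1) (Dp t j (Dp t j 1)) 1 t y) =
      Rf p (Dp t i 1) t y * (∑ j, Af p (Dp t j (Dp t j (Dp t i 1))) t y)
      - 1 / 2 * Rf p (Dp t i 1) t y ^ 2 * ∑ j, Af p (Dp t j (Dp t j 1)) t y := by
    rw [Finset.mul_sum, Finset.mul_sum, ← Finset.sum_sub_distrib]
    refine Finset.sum_congr rfl fun j _ => ?_
    simp only [Qf, Rf_one hp hpos ht]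
    generalize Rf p (Dp t i 1) t y = r
    unfold Rf
    field_simp
  rw [e5, e1, e2, e4]
  unfold dQ Qf
  simp only [Rf_one hp hpos ht]
  unfold Rf
  field_simp
  ring

lemma J_eq (hp : Integrable p) (hpos : ∀ z, 0 < p z) {t : ℝ} (ht : 0 < t) :
    Jfun p t = (1 / (k : ℝ)) * ∑ i, (t ^ 2)⁻¹ * ∫ y, Qf p (X i) (X i) 1 1 t y := by
  unfold Jfun fisherInfo gradSqNorm
  congr 1
  simp_rw [log_pt_fderiv hp hpos ht]
  have : ∀ y, (∑ i, Rf p (Dp t i 1) t y ^ 2) * pt p t y =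
      ∑ i, (t ^ 2)⁻¹ * Qf p (X i) (X i) 1 1 t y := by
    intro y
    rw [Finset.sum_mul]
    refine Finset.sum_congr rfl fun i _ => ?_
    simp only [Qf, Rf_one hp hpos ht, pt_eq_Af p ht]
    unfold Rf
    rw [Dp_one, Af_C_mul]
    field_simp
  simp_rw [this]
  rw [integral_finsetSum _ fun i _ => (Qf_integrable hp hpos _ _ _ _ ht).const_mul _]
  simp_rw [integral_const_mul]

lemma hess_eq (hp : Integrable p) (hpos : ∀ z, 0 < p z) {t : ℝ} (ht : 0 < t) :
    ∫ y, hessSqNorm (fun w => Real.log (pt p t w)) y * pt p t y =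
      ∑ i, ∑ j, ∫ y, Vf p i j t y ^ 2 * Af p 1 t y := by
  unfold hessSqNorm
  simp_rw [log_pt_hess hp hpos ht, pt_eq_Af p ht, Finset.sum_mul]
  rw [integral_finsetSum _ fun i _ => integrable_finsetSum _ fun j _ => V_sq_integrable hp hpos ht _ _]
  rw [Finset.sum_comm]
  have : ∀ i, ∫ y, ∑ j, Vf p j i t y ^ 2 * Af p 1 t y = ∑ j, ∫ y, Vf p j i t y ^ 2 * Af p 1 t y :=
    fun i => integral_finsetSum _ fun j _ => V_sq_integrable hp hpos ht _ _
  simp_rw [this]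

lemma J_hasDerivAt (hp : Integrable p) (hpos : ∀ z, 0 < p z) {t : ℝ} (ht : 0 < t) :
    HasDerivAt (Jfun p) (-((1 / (k : ℝ)) *
      ∫ y, hessSqNorm (fun w => Real.log (pt p t w)) y * pt p t y)) t := by
  have h1 : HasDerivAt (fun t : ℝ => (t ^ 2)⁻¹) (-2 / t ^ 3) t := by
    refine ((hasDerivAt_pow 2 t).fun_inv (by positivity)).congr_deriv ?_
    field_simp
    norm_num [mul_comm]
  have h := (HasDerivAt.fun_sum (u := (Finset.univ : Finset (Fin k))) fun i _ =>
    h1.mul (intQ_hasDerivAt hp hpos ht i).2).const_mul (1 / (k : ℝ))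
  refine (h.congr_deriv ?_).congr_of_eventuallyEq ?_
  · rw [hess_eq hp hpos ht, ← mul_neg, ← Finset.sum_neg_distrib]
    congr 1
    refine Finset.sum_congr rfl fun i _ => ?_
    rw [← Finset.sum_neg_distrib]
    simp_rw [← ibp_main hp hpos ht]
    rw [← integral_finsetSum]
    · simp_rw [← heat_pointwise hp hpos ht]
      rw [integral_add ((Qf_integrable hp hpos _ _ _ _ ht).const_mul _)
        ((intQ_hasDerivAt hp hpos ht i).1.const_mul _), integral_const_mul, integral_const_mul]
      ring
    · intro j _
      exact (Qf_integrable hp hpos _ _ _ _ ht).sub ((Qf_integrable hp hpos _ _ _ _ ht).const_mul _)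
  · filter_upwards [Ioi_mem_nhds ht] with s hs
    exact J_eq hp hpos hs

end fixed

lemma norm_sq_le_sqNorm {k : ℕ} (x : Fin k → ℝ) : ‖x‖ ^ 2 ≤ sqNorm x := by
  have : ‖x‖ ≤ √(sqNorm x) := by
    rw [pi_norm_le_iff_of_nonneg (Real.sqrt_nonneg _)]
    intro i
    rw [Real.norm_eq_abs]
    exact Real.abs_le_sqrt (sq_le_sqNorm x i)
  calc ‖x‖ ^ 2 ≤ √(sqNorm x) ^ 2 := by gcongr
    _ = _ := Real.sq_sqrt (sqNorm_nonneg x)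

lemma gauss_decay {k : ℕ} : Tendsto (fun x : Fin k → ℝ => ‖x‖ ^ k * gaussDensity 1 x)
    (Bornology.cobounded (Fin k → ℝ)) (𝓝 0) := by
  have h1 := ((Real.tendsto_pow_mul_exp_neg_atTop_nhds_zero k).comp
    (tendsto_norm_cobounded_atTop (E := Fin k → ℝ))).const_mul
      ((2 * Real.pi * 1) ^ (-(k : ℝ) / 2) * Real.exp (1 / 2))
  rw [mul_zero] at h1
  refine squeeze_zero (fun x => mul_nonneg (by positivity) (gaussDensity_pos one_pos x).le) ?_ h1
  intro x
  simp only [Function.comp_apply, gaussDensity]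
  have h2 : Real.exp (-sqNorm x / (2 * 1)) ≤ Real.exp (1 / 2) * Real.exp (-‖x‖) := by
    rw [← Real.exp_add]
    apply Real.exp_le_exp.2
    have := norm_sq_le_sqNorm x
    nlinarith [sq_nonneg (‖x‖ - 1)]
  calc ‖x‖ ^ k * ((2 * Real.pi * 1) ^ (-(k : ℝ) / 2) * Real.exp (-sqNorm x / (2 * 1)))
      ≤ ‖x‖ ^ k * ((2 * Real.pi * 1) ^ (-(k : ℝ) / 2) * (Real.exp (1 / 2) * Real.exp (-‖x‖))) := by
        gcongr
    _ = _ := by ring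

lemma gauss_scale {k : ℕ} {t : ℝ} (ht : 0 < t) (w : Fin k → ℝ) :
    ((√t)⁻¹) ^ k * gaussDensity 1 ((√t)⁻¹ • w) = gaussDensity t w := by
  unfold gaussDensity
  have e1 : sqNorm ((√t)⁻¹ • w) = sqNorm w / t := by
    unfold sqNorm
    simp only [Pi.smul_apply, smul_eq_mul, mul_pow, inv_pow, Real.sq_sqrt ht.le, ← Finset.mul_sum]
    field_simp
  have e2 : (2 * Real.pi * t) ^ (-(k : ℝ) / 2) =
      (2 * Real.pi * 1) ^ (-(k : ℝ) / 2) * ((√t)⁻¹) ^ k := by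
    rw [Real.mul_rpow (by positivity) ht.le, mul_one]
    congr 1
    rw [Real.sqrt_eq_rpow, ← Real.rpow_neg ht.le, ← Real.rpow_natCast, ← Real.rpow_mul ht.le]
    congr 1; ring
  rw [e1, e2]
  have e3 : -(sqNorm w / t) / (2 * 1) = -sqNorm w / (2 * t) := by field_simp
  rw [e3]; ring

lemma Af_tendsto {k : ℕ} {q : (Fin k → ℝ) → ℝ} (hq : Integrable q) (hc : Continuous q)
    (y : Fin k → ℝ) : Tendsto (fun t => Af q 1 t y) (𝓝[>] 0) (𝓝 (q y)) := by
  have h := tendsto_integral_comp_smul_smul_of_integrable' (μ := (volume : Measure (Fin k → ℝ)))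
    (φ := gaussDensity 1) (fun x => (gaussDensity_pos one_pos x).le)
    (integral_gaussDensity one_pos) (by simpa using gauss_decay (k := k)) hq
    (hc.continuousAt (x := y))
  have hs : Tendsto (fun t : ℝ => (√t)⁻¹) (𝓝[>] 0) atTop := by
    apply Tendsto.inv_tendsto_nhdsGT_zero
    refine tendsto_nhdsWithin_iff.2 ⟨?_, ?_⟩
    · have : Tendsto (fun t : ℝ => √t) (𝓝 0) (𝓝 (√0)) := Real.continuous_sqrt.tendsto 0
      rw [Real.sqrt_zero] at this
      exact this.mono_left nhdsWithin_le_nhds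
    · filter_upwards [self_mem_nhdsWithin] with t ht using Real.sqrt_pos.2 ht
  refine (h.comp hs).congr' ?_
  filter_upwards [self_mem_nhdsWithin] with t ht
  simp only [Function.comp_apply, Af]
  congr 1; ext z
  rw [Module.finrank_fin_fun, gauss_scale ht]
  simp [mul_comm]

lemma fatou_squeeze {k : ℕ} {g : ℝ → (Fin k → ℝ) → ℝ} {s : (Fin k → ℝ) → ℝ} (hs : Integrable s)
    (hs0 : ∀ y, 0 ≤ s y) (hg0 : ∀ t, 0 < t → ∀ y, 0 ≤ g t y) (hgi : ∀ t, 0 < t → Integrable (g t))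
    (hle : ∀ t, 0 < t → ∫ y, g t y ≤ ∫ y, s y)
    (hlim : ∀ y, Tendsto (fun t => g t y) (𝓝[>] 0) (𝓝 (s y))) :
    Tendsto (fun t => ∫ y, g t y) (𝓝[>] 0) (𝓝 (∫ y, s y)) := by
  classical
  set G : ℝ → (Fin k → ℝ) → ENNReal := fun t y => if 0 < t then ENNReal.ofReal (g t y) else 0 with hG
  have hGt : ∀ t, 0 < t → ∫⁻ y, G t y = ENNReal.ofReal (∫ y, g t y) := by
    intro t ht
    simp only [hG, if_pos ht]
    exact (ofReal_integral_eq_lintegral_ofReal (hgi t ht)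
      (Eventually.of_forall (hg0 t ht))).symm
  have hS : ∫⁻ y, ENNReal.ofReal (s y) = ENNReal.ofReal (∫ y, s y) :=
    (ofReal_integral_eq_lintegral_ofReal hs (Eventually.of_forall hs0)).symm
  have hmeas : ∀ t, AEMeasurable (G t) := by
    intro t
    by_cases ht : 0 < t
    · simp only [hG, if_pos ht]
      exact (hgi t ht).aestronglyMeasurable.aemeasurable.ennreal_ofReal
    · simp only [hG, if_neg ht]; exact aemeasurable_const
  have hl : ∀ y, liminf (fun t => G t y) (𝓝[>] (0 : ℝ)) = ENNReal.ofReal (s y) := by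
    intro y
    apply Tendsto.liminf_eq
    refine ((ENNReal.continuous_ofReal.tendsto _).comp (hlim y)).congr' ?_
    filter_upwards [self_mem_nhdsWithin] with t ht
    simp only [hG, Function.comp_apply]
    rw [if_pos (Set.mem_Ioi.1 ht)]
  have hF := lintegral_liminf_le' (μ := volume) (u := 𝓝[>] (0 : ℝ)) hmeas
  simp_rw [hl] at hF
  rw [hS] at hF
  have hT : Tendsto (fun t => ∫⁻ y, G t y) (𝓝[>] (0 : ℝ)) (𝓝 (ENNReal.ofReal (∫ y, s y))) := by
    refine tendsto_of_le_liminf_of_limsup_le hF ?_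
    refine limsup_le_of_le (by isBoundedDefault) ?_
    filter_upwards [self_mem_nhdsWithin] with t ht
    rw [hGt t ht]
    exact ENNReal.ofReal_le_ofReal (hle t ht)
  have h2 := (ENNReal.tendsto_toReal ENNReal.ofReal_ne_top).comp hT
  rw [ENNReal.toReal_ofReal (integral_nonneg hs0)] at h2
  refine h2.congr' ?_
  filter_upwards [self_mem_nhdsWithin] with t ht
  rw [Function.comp_apply, hGt t ht, ENNReal.toReal_ofReal (integral_nonneg (hg0 t ht))]

section cont
variable {k : ℕ} {p : (Fin k → ℝ) → ℝ}

/-- partial derivative -/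
def dp (p : (Fin k → ℝ) → ℝ) (i : Fin k) (z : Fin k → ℝ) : ℝ := fderiv ℝ p z (Pi.single i 1)

/-- `(∂ᵢ p)² / p` -/
def sp (p : (Fin k → ℝ) → ℝ) (i : Fin k) (z : Fin k → ℝ) : ℝ := dp p i z ^ 2 / p z

lemma dp_continuous (hpd : ContDiff ℝ 2 p) (i : Fin k) : Continuous (dp p i) :=
  (hpd.continuous_fderiv (by norm_num)).clm_apply continuous_const

lemma sp_continuous (hpos : ∀ z, 0 < p z) (hpd : ContDiff ℝ 2 p) (i : Fin k) :
    Continuous (sp p i) :=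
  ((dp_continuous hpd i).pow 2).div hpd.continuous fun z => (hpos z).ne'

lemma grad_log_eq (hpos : ∀ z, 0 < p z) (hpd : ContDiff ℝ 2 p) (z : Fin k → ℝ) :
    gradSqNorm (fun w => Real.log (p w)) z * p z = ∑ i, sp p i z := by
  unfold gradSqNorm
  rw [Finset.sum_mul]
  refine Finset.sum_congr rfl fun i _ => ?_
  have h := ((hpd.differentiable (by norm_num)) z).hasFDerivAt.log (hpos z).ne'
  have := hpos z
  rw [h.fderiv, smul_apply, smul_eq_mul, sp, dp]
  field_simp

lemma sp_nonneg (hpos : ∀ z, 0 < p z) (i : Fin k) (z : Fin k → ℝ) : 0 ≤ sp p i z :=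
  div_nonneg (sq_nonneg _) (hpos z).le

lemma sp_integrable (hpos : ∀ z, 0 < p z) (hpd : ContDiff ℝ 2 p)
    (hJ : Integrable (fun z => gradSqNorm (fun w => Real.log (p w)) z * p z)) (i : Fin k) :
    Integrable (sp p i) := by
  refine hJ.mono' (sp_continuous hpos hpd i).aestronglyMeasurable (Eventually.of_forall fun z => ?_)
  rw [Real.norm_of_nonneg (sp_nonneg hpos i z), grad_log_eq hpos hpd]
  exact Finset.single_le_sum (f := fun i => sp p i z) (fun i _ => sp_nonneg hpos i z)
    (Finset.mem_univ i)

lemma dp_integrable (hp : Integrable p) (hpos : ∀ z, 0 < p z) (hpd : ContDiff ℝ 2 p)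
    (hJ : Integrable (fun z => gradSqNorm (fun w => Real.log (p w)) z * p z)) (i : Fin k) :
    Integrable (dp p i) := by
  refine (hp.add (sp_integrable hpos hpd hJ i)).mono' (dp_continuous hpd i).aestronglyMeasurable
    (Eventually.of_forall fun z => ?_)
  have h0 := hpos z
  rw [Real.norm_eq_abs, Pi.add_apply, sp, ← sq_abs, ← sub_nonneg]
  have : p z + |dp p i z| ^ 2 / p z - |dp p i z| =
    ((p z - |dp p i z|) ^ 2 + p z * |dp p i z|) / p z := by field_simp; ring
  rw [this]; positivity

lemma Af_ibp (hp : Integrable p) (hpos : ∀ z, 0 < p z) (hpd : ContDiff ℝ 2 p)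
    (hJ : Integrable (fun z => gradSqNorm (fun w => Real.log (p w)) z * p z)) (i : Fin k)
    {t : ℝ} (ht : 0 < t) (y : Fin k → ℝ) :
    Af p (Dp t i 1) t y = Af (dp p i) 1 t y := by
  set g : (Fin k → ℝ) → ℝ := fun z => eval (y - z) (1 : MvPolynomial (Fin k) ℝ) *
    gaussDensity t (y - z) with hg
  have hgd : ∀ z, HasFDerivAt g _ z := fun z =>
    (kernel_hasFDerivAt t 1 (y - z)).comp z ((hasFDerivAt_id z).const_sub y)
  have hg' : ∀ z, fderiv ℝ g z (Pi.single i 1) =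
      - (eval (y - z) (Dp t i 1) * gaussDensity t (y - z)) := by
    intro z
    rw [(hgd z).fderiv]
    simp [sum_apply, Pi.single_apply]
  have h := integral_mul_fderiv_eq_neg_fderiv_mul_of_integrable (μ := volume) (f := p)
    (g := g) (v := Pi.single i 1) (Af_integrand (dp_integrable hp hpos hpd hJ i) 1 ht y)
    (by
      simp_rw [hg', mul_neg]
      exact (Af_integrand hp _ ht y).neg)
    (Af_integrand hp 1 ht y)
    (fun x _ => hpd.differentiable (by norm_num) x) (fun x _ => (hgd x).differentiableAt)
  simp_rw [hg', mul_neg, integral_neg] at h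
  exact neg_injective h

lemma Af_sp_bound (hp : Integrable p) (hpos : ∀ z, 0 < p z) (hpd : ContDiff ℝ 2 p)
    (hJ : Integrable (fun z => gradSqNorm (fun w => Real.log (p w)) z * p z)) (i : Fin k)
    {t : ℝ} (ht : 0 < t) (y : Fin k → ℝ) :
    Af (dp p i) 1 t y ^ 2 / Af p 1 t y ≤ Af (sp p i) 1 t y := by
  have e1 : ∀ z, dp p i z / p z * (p z * (eval (y - z) (1 : MvPolynomial (Fin k) ℝ) *
      gaussDensity t (y - z))) = dp p i z * (eval (y - z) (1 : MvPolynomial (Fin k) ℝ) *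
      gaussDensity t (y - z)) := fun z => by
    have := hpos z
    field_simp
  have e2 : ∀ z, (dp p i z / p z) ^ 2 * (p z * (eval (y - z) (1 : MvPolynomial (Fin k) ℝ) *
      gaussDensity t (y - z))) = sp p i z * (eval (y - z) (1 : MvPolynomial (Fin k) ℝ) *
      gaussDensity t (y - z)) := fun z => by
    have := hpos z
    unfold sp
    field_simp
  have := weighted_CS (m := fun z => p z * (eval (y - z) (1 : MvPolynomial (Fin k) ℝ) *
      gaussDensity t (y - z))) (h := fun z => dp p i z / p z)
    (fun z => by
      have := gaussDensity_pos ht (y - z)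
      have := hpos z
      simp only [map_one]; positivity) (Af_integrand hp 1 ht y) (Af_one_pos hp hpos ht y)
    (by simp_rw [e1]; exact Af_integrand (dp_integrable hp hpos hpd hJ i) 1 ht y)
    (by simp_rw [e2]; exact Af_integrand (sp_integrable hpos hpd hJ i) 1 ht y)
  simp_rw [e1, e2] at this
  exact this

lemma integral_Af_one {q : (Fin k → ℝ) → ℝ} (hq : Integrable q) {t : ℝ} (ht : 0 < t) :
    ∫ y, Af q 1 t y = ∫ y, q y := by
  have h := integral_convolution (μ := (volume : Measure (Fin k → ℝ)))
    (ν := (volume : Measure (Fin k → ℝ))) (ContinuousLinearMap.mul ℝ ℝ) hq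
    (kernel_integrable (1 : MvPolynomial (Fin k) ℝ) ht)
  have e : ∫ y, eval y (1 : MvPolynomial (Fin k) ℝ) * gaussDensity t y = 1 := by
    simpa using integral_gaussDensity (k := k) ht
  rw [e] at h
  simpa [convolution, Af] using h

lemma J_tendsto (hp : Integrable p) (hpos : ∀ z, 0 < p z) (hpd : ContDiff ℝ 2 p)
    (hJ : Integrable (fun z => gradSqNorm (fun w => Real.log (p w)) z * p z)) :
    Tendsto (Jfun p) (𝓝[>] 0) (𝓝 (Jfun p 0)) := by
  have hdi := dp_integrable hp hpos hpd hJ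
  have hsi := sp_integrable hpos hpd hJ
  have hgi : ∀ i t, 0 < t → Integrable (fun y => Af (dp p i) 1 t y ^ 2 / Af p 1 t y) := by
    intro i t ht
    refine (Af_integrable (hsi i) 1 ht).mono' ?_ (Eventually.of_forall fun y => ?_)
    · exact (((Af_continuous (hdi i) 1 ht).pow 2).div (Af_continuous hp 1 ht) fun y =>
        (Af_one_pos hp hpos ht y).ne').aestronglyMeasurable
    · have := Af_one_pos hp hpos ht y
      rw [Real.norm_of_nonneg (by positivity)]
      exact Af_sp_bound hp hpos hpd hJ i ht y
  have hi : ∀ i, Tendsto (fun t => ∫ y, Af (dp p i) 1 t y ^ 2 / Af p 1 t y) (𝓝[>] 0)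
      (𝓝 (∫ y, sp p i y)) := by
    intro i
    refine fatou_squeeze (hsi i) (sp_nonneg hpos i) (fun t ht y => ?_) (hgi i) (fun t ht => ?_)
      (fun y => ?_)
    · have := Af_one_pos hp hpos ht y
      positivity
    · rw [← integral_Af_one (hsi i) ht]
      exact integral_mono (hgi i t ht) (Af_integrable (hsi i) 1 ht)
        fun y => Af_sp_bound hp hpos hpd hJ i ht y
    · exact ((Af_tendsto (hdi i) (dp_continuous hpd i) y).pow 2).div
        (Af_tendsto hp hpd.continuous y) (hpos y).ne'
  have hsum := (tendsto_finsetSum Finset.univ fun i _ => hi i).const_mul (1 / (k : ℝ))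
  have h0 : Jfun p 0 = 1 / (k : ℝ) * ∑ i, ∫ y, sp p i y := by
    unfold Jfun fisherInfo
    have : pt p 0 = p := by ext y; simp [pt]
    rw [this]
    simp_rw [grad_log_eq hpos hpd]
    rw [integral_finsetSum _ fun i _ => hsi i]
  rw [h0]
  refine hsum.congr' ?_
  filter_upwards [self_mem_nhdsWithin] with t ht
  have ht : 0 < t := ht
  rw [J_eq hp hpos ht]
  congr 1
  refine Finset.sum_congr rfl fun i _ => ?_
  rw [← integral_const_mul]
  congr 1; ext y
  rw [← Af_ibp hp hpos hpd hJ i ht, Dp_one, Af_C_mul]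
  have := Af_one_pos hp hpos ht y
  simp only [Qf, Rf_one hp hpos ht]
  unfold Rf
  field_simp

end cont

/-- second-order small-noise expansion of the Bayes training error.  If the
Hessian-Fisher quantity converges as `t → 0+` to its value `L` at `t = 0`, then `J` is right
differentiable at `0` with `J'(0) = −L`, and
`Train(σ²) = σ⁴·J_π − σ⁶·L + o(σ⁶)` as `σ² → 0+`. -/
theorem stmt_18 {n : ℕ} (hn : 1 ≤ n)
    (p : (Fin n → ℝ) → ℝ) (hppos : ∀ z, 0 < p z) (hpdiff : ContDiff ℝ 2 p)
    (hpint : Integrable p) (hpone : ∫ z, p z = 1)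
    (hmean : ∀ i, Integrable (fun z => z i * p z) ∧ ∫ z, z i * p z = 0)
    (hmom : Integrable (fun z => sqNorm z * p z))
    (hJfin : Integrable (fun z => gradSqNorm (fun w => Real.log (p w)) z * p z))
    (hLfin : Integrable (fun y => hessSqNorm (fun w => Real.log (p w)) y * p y))
    (hlim :
      Tendsto
        (fun t => (1 / (n : ℝ)) *
          ∫ y, hessSqNorm (fun w => Real.log (pt p t w)) y * pt p t y)
        (nhdsWithin 0 (Set.Ioi 0))
        (nhds ((1 / (n : ℝ)) * ∫ y, hessSqNorm (fun w => Real.log (p w)) y * p y))) :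
    HasDerivWithinAt (Jfun p)
        (-((1 / (n : ℝ)) * ∫ y, hessSqNorm (fun w => Real.log (p w)) y * p y))
        (Set.Ici 0) 0 ∧
      (fun t => TrainFun p t - t ^ 2 * Jfun p 0 +
          t ^ 3 * ((1 / (n : ℝ)) * ∫ y, hessSqNorm (fun w => Real.log (p w)) y * p y))
        =o[nhdsWithin 0 (Set.Ioi 0)] (fun t => t ^ 3) := by
  have hd := fun (t : ℝ) (ht : 0 < t) => J_hasDerivAt hpint hppos ht
  have hJ0 := J_tendsto hpint hppos hpdiff hJfin
  set L := (1 / (n : ℝ)) * ∫ y, hessSqNorm (fun w => Real.log (p w)) y * p y with hL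
  have main : HasDerivWithinAt (Jfun p) (-L) (Set.Ici 0) 0 := by
    refine hasDerivWithinAt_Ici_of_tendsto_deriv (s := Set.Ioi 0)
      (fun t ht => (hd t ht).differentiableAt.differentiableWithinAt) hJ0 self_mem_nhdsWithin ?_
    refine hlim.neg.congr' ?_
    filter_upwards [self_mem_nhdsWithin] with t ht
    exact (hd t ht).deriv.symm
  refine ⟨main, ?_⟩
  have h1 := (main.mono Set.Ioi_subset_Ici_self).isLittleO
  have h2 : (fun t : ℝ => Jfun p t - Jfun p 0 + t * L) =o[nhdsWithin 0 (Set.Ioi 0)]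
      (fun t : ℝ => t) := by
    simpa [sub_eq_add_neg] using h1
  have h3 := (Asymptotics.isBigO_refl (fun t : ℝ => t ^ 2) (nhdsWithin 0 (Set.Ioi 0))).mul_isLittleO h2
  refine (h3.congr_left fun t => ?_).congr_right fun t => ?_
  · simp only [TrainFun]; ring
  · ring
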